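/- Let l1, l2, l3, m1, m2 be positive reals, l2 ≠ l3, c real, and set α = l1/l2, γ = m1/m2, σ = l1/l2 + l1/l3. For every real x2 such that all denominators below are nonzero, putting z = cos x2, zdot = −c*sin x2/(l2*m2*(l2−l3)) and zddot = −c²*cos x2/(l2²*m2²*(l2−l3)²), one has the two identities zddot + a(x2)·zdot = zdot²·p(z) and b(x2) = zdot²·q(z). Hence the change of independent variable t ↦ z = cos x2(t) transforms the equation Ẍ + a Ẋ + b X = 0 into X'' + p(z)X' + q(z)X = 0. -/

import Mathlib

/-- Denominator factor
`F1(x2) = 4 l2² l3² m2 + l1² (l2+l3)(l3 m1 + (l2+l3) m2) + 4 l1 l2 l3 (l2+l3) m2 cos x2`. -/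
noncomputable def F1den (l1 l2 l3 m1 m2 x2 : ℝ) : ℝ :=
  4 * l2 ^ 2 * l3 ^ 2 * m2 + l1 ^ 2 * (l2 + l3) * (l3 * m1 + (l2 + l3) * m2)
    + 4 * l1 * l2 * l3 * (l2 + l3) * m2 * Real.cos x2

/-- Denominator factor `F2(x2) = 2 l3 m1 + (l2+l3) m2 - (l2+l3) m2 cos(2 x2)`. -/
noncomputable def F2den (l2 l3 m1 m2 x2 : ℝ) : ℝ :=
  2 * l3 * m1 + (l2 + l3) * m2 - (l2 + l3) * m2 * Real.cos (2 * x2)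

/-- Coefficient `a(x2)` of the reduced second-order equation. -/
noncomputable def acoef (l1 l2 l3 m1 m2 c x2 : ℝ) : ℝ :=
  (4 * c * (l2 + l3) * (2 * l2 * l3 + l1 * (l2 + l3) * Real.cos x2) *
      (l1 * l3 * m1 + l1 * (l2 + l3) * m2 + 2 * l2 * l3 * m2 * Real.cos x2) * Real.sin x2) /
    (l2 * (l2 - l3) * F1den l1 l2 l3 m1 m2 x2 * F2den l2 l3 m1 m2 x2)

/-- Coefficient `b(x2)` of the reduced second-order equation. -/
noncomputable def bcoef (l1 l2 l3 m1 m2 c x2 : ℝ) : ℝ :=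
  (2 * c ^ 2 * (2 * l2 * l3 + l1 * (l2 + l3) * Real.cos x2) *
      (4 * l1 * l2 * l3 * (l2 + l3) * m2
        + (4 * l2 ^ 2 * l3 ^ 2 * m2 + l1 ^ 2 * (l2 + l3) * (l3 * m1 + (l2 + l3) * m2)) *
          Real.cos x2)) /
    (l1 * l2 ^ 2 * (l2 - l3) ^ 2 * m2 * F1den l1 l2 l3 m1 m2 x2 * F2den l2 l3 m1 m2 x2)

/-- Rational coefficient `p(z)` (with `α = l1/l2`, `γ = m1/m2`, `σ = l1/l2 + l1/l3`). -/
noncomputable def pcoef (α γ σ z : ℝ) : ℝ :=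
  z / (z ^ 2 - 1) + 2 * σ * z / ((z ^ 2 - 1) * σ - α * γ)
    - 4 * σ / (4 + σ * (4 * z + σ + α * γ))

/-- Rational coefficient `q(z)` (with `α = l1/l2`, `γ = m1/m2`, `σ = l1/l2 + l1/l3`). -/
noncomputable def qcoef (α γ σ z : ℝ) : ℝ :=
  (σ * z + 2) * (4 * σ + z * (4 + σ * (σ + α * γ))) /
    ((z ^ 2 - 1) * ((z ^ 2 - 1) * σ - α * γ) * (4 + σ * (4 * z + σ + α * γ)))

/-- The change of variable `z = cos x2` transforms `Ẍ + a Ẋ + b X = 0` into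
`X'' + p(z) X' + q(z) X = 0`: the two transformation identities. -/
theorem stmt_5 (l1 l2 l3 m1 m2 c : ℝ)
    (hl1 : 0 < l1) (hl2 : 0 < l2) (hl3 : 0 < l3)
    (hm1 : 0 < m1) (hm2 : 0 < m2) (hne : l2 ≠ l3) :
    ∀ x2 : ℝ,
      F1den l1 l2 l3 m1 m2 x2 ≠ 0 →
      F2den l2 l3 m1 m2 x2 ≠ 0 →
      Real.cos x2 ^ 2 - 1 ≠ 0 →
      (Real.cos x2 ^ 2 - 1) * (l1 / l2 + l1 / l3) - (l1 / l2) * (m1 / m2) ≠ 0 →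
      4 + (l1 / l2 + l1 / l3) *
        (4 * Real.cos x2 + (l1 / l2 + l1 / l3) + (l1 / l2) * (m1 / m2)) ≠ 0 →
      (-(c ^ 2 * Real.cos x2 / (l2 ^ 2 * m2 ^ 2 * (l2 - l3) ^ 2))
          + acoef l1 l2 l3 m1 m2 c x2 * (-(c * Real.sin x2 / (l2 * m2 * (l2 - l3))))
        = (-(c * Real.sin x2 / (l2 * m2 * (l2 - l3)))) ^ 2 *
            pcoef (l1 / l2) (m1 / m2) (l1 / l2 + l1 / l3) (Real.cos x2)) ∧
      (bcoef l1 l2 l3 m1 m2 c x2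
        = (-(c * Real.sin x2 / (l2 * m2 * (l2 - l3)))) ^ 2 *
            qcoef (l1 / l2) (m1 / m2) (l1 / l2 + l1 / l3) (Real.cos x2)) := by
  intro x2 h1 h2 h3 h4 h5
  have hd : l2 - l3 ≠ 0 := sub_ne_zero.mpr hne
  have hl1' := hl1.ne'
  have hl2' := hl2.ne'
  have hl3' := hl3.ne'
  have hm2' := hm2.ne'
  have hs : Real.sin x2 ^ 2 = -(Real.cos x2 ^ 2 - 1) := by
    rw [Real.sin_sq]; ring
  have e1 : F1den l1 l2 l3 m1 m2 x2 = l2 ^ 2 * l3 ^ 2 * m2 * (4 + (l1 / l2 + l1 / l3) *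
        (4 * Real.cos x2 + (l1 / l2 + l1 / l3) + (l1 / l2) * (m1 / m2))) := by
    unfold F1den; field_simp; ring
  have e2 : F2den l2 l3 m1 m2 x2 = -(2 * l2 * l3 * m2 / l1) *
      ((Real.cos x2 ^ 2 - 1) * (l1 / l2 + l1 / l3) - (l1 / l2) * (m1 / m2)) := by
    unfold F2den; rw [Real.cos_two_mul]; field_simp; ring
  have n1 : 2 * l2 * l3 + l1 * (l2 + l3) * Real.cos x2
      = l2 * l3 * ((l1 / l2 + l1 / l3) * Real.cos x2 + 2) := by
    field_simp; ring
  have n2 : l1 * l3 * m1 + l1 * (l2 + l3) * m2 + 2 * l2 * l3 * m2 * Real.cos x2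
      = l2 * l3 * m2 * (2 * Real.cos x2 + (l1 / l2 + l1 / l3) + (l1 / l2) * (m1 / m2)) := by
    field_simp; ring
  have n3 : 4 * l1 * l2 * l3 * (l2 + l3) * m2
        + (4 * l2 ^ 2 * l3 ^ 2 * m2 + l1 ^ 2 * (l2 + l3) * (l3 * m1 + (l2 + l3) * m2)) *
          Real.cos x2 = l2 ^ 2 * l3 ^ 2 * m2 * (4 * (l1 / l2 + l1 / l3) + Real.cos x2 *
          (4 + (l1 / l2 + l1 / l3) * ((l1 / l2 + l1 / l3) + (l1 / l2) * (m1 / m2)))) := by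
    field_simp; ring
  have n4 : l2 + l3 = l2 * l3 / l1 * (l1 / l2 + l1 / l3) := by
    field_simp; ring
  have hk : (-(c * Real.sin x2 / (l2 * m2 * (l2 - l3)))) ^ 2
      = -(c ^ 2 * (Real.cos x2 ^ 2 - 1) / (l2 * m2 * (l2 - l3)) ^ 2) := by
    rw [neg_sq, div_pow, mul_pow, hs]; ring
  constructor
  · have ha : acoef l1 l2 l3 m1 m2 c x2 * (-(c * Real.sin x2 / (l2 * m2 * (l2 - l3))))
        = 4 * c ^ 2 * (l2 + l3) * (2 * l2 * l3 + l1 * (l2 + l3) * Real.cos x2) *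
          (l1 * l3 * m1 + l1 * (l2 + l3) * m2 + 2 * l2 * l3 * m2 * Real.cos x2) *
          (Real.cos x2 ^ 2 - 1) / (l2 ^ 2 * m2 * (l2 - l3) ^ 2 *
            F1den l1 l2 l3 m1 m2 x2 * F2den l2 l3 m1 m2 x2) := by
      have : Real.cos x2 ^ 2 - 1 = -Real.sin x2 ^ 2 := by rw [hs]; ring
      rw [this]; unfold acoef; field_simp
    rw [ha, hk, n1, n2, n4, e1, e2]
    unfold pcoef
    generalize (m1 / m2) = g at *
    generalize (l1 / l2 + l1 / l3) = σ at *
    generalize (l1 / l2) * g = w at *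
    generalize Real.cos x2 = z at *
    clear e1 e2 n1 n2 n3 n4 ha hk hs h1 h2
    generalize hA : z ^ 2 - 1 = A at *
    generalize hB : A * σ - w = B at *
    generalize hC : 4 + σ * (4 * z + σ + w) = C at *
    have key : (σ * z + 2) * (2 * z + σ + w) = z * C - 2 * B := by
      rw [← hC, ← hB, ← hA]; ring
    generalize l2 - l3 = d at *
    have : 4 * c ^ 2 * (l2 * l3 / l1 * σ) * (l2 * l3 * (σ * z + 2)) *
        (l2 * l3 * m2 * (2 * z + σ + w)) = 4 * c ^ 2 * (l2 * l3 / l1 * σ) * (l2 * l3) *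
        (l2 * l3 * m2) * (z * C - 2 * B) := by rw [← key]; ring
    rw [this]
    field_simp
    ring
  · rw [hk]
    unfold bcoef qcoef
    rw [n3, n1, e1, e2]
    generalize (m1 / m2) = g at *
    generalize (l1 / l2 + l1 / l3) = σ at *
    generalize (l1 / l2) * g = w at *
    generalize Real.cos x2 = z at *
    clear e1 e2 n1 n2 n3 n4 hk hs h1 h2
    generalize z ^ 2 - 1 = A at *
    generalize A * σ - w = B at *
    generalize 4 + σ * (4 * z + σ + w) = C at *
    generalize l2 - l3 = d at *
    field_simp
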